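/- arXiv:1106.2839 — 2 statements merged into one kernel-verified Lean document; each statement's English description precedes it below -/
import Mathlib

section
/- For w ∈ S_N, rep(w) = rep(w̄) + |newrep(w)|, where newrep(w) = {k : s_k ∈ supp(w̄) and w^{-1}(N) ≤ k}. -/
/-!
Common framework.  Permutations of `{1, …, m}` are modelled as `Equiv.Perm (Fin m)`
with 0-based positions and values.  The simple reflection `sr m i` (for
`0 ≤ i ≤ m - 2`, corresponding to the paper's `s_{i+1}`) swaps the values `i` and
`i + 1`.  Cut statistics `Mstat w k` / `mstat w k` (the paper's `M_{k+1}`/`m_{k+1}`)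
are respectively the maximum of the first `k + 1` entries and the minimum of the
remaining entries of the one-line notation of `w`.
-/

/-- The simple reflection swapping `i` and `i + 1` (0-based) in the symmetric group
on `Fin m`; the identity if out of range. -/
def sr (m i : ℕ) : Equiv.Perm (Fin m) :=
  if h : i + 1 < m then Equiv.swap ⟨i, Nat.lt_of_succ_lt h⟩ ⟨i + 1, h⟩ else 1

/-- `l` is a word in the simple reflections whose product is `w`. -/
def IsWord (m : ℕ) (l : List ℕ) (w : Equiv.Perm (Fin m)) : Prop :=
  (∀ i ∈ l, i + 1 < m) ∧ (l.map (sr m)).prod = w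

/-- The Coxeter length `ℓ(w)`: the minimal length of a word expressing `w`. -/
noncomputable def len {m : ℕ} (w : Equiv.Perm (Fin m)) : ℕ :=
  sInf {c | ∃ l : List ℕ, IsWord m l w ∧ l.length = c}

/-- `l` is a reduced decomposition of `w`. -/
def IsReducedWord {m : ℕ} (w : Equiv.Perm (Fin m)) (l : List ℕ) : Prop :=
  IsWord m l w ∧ l.length = len w

/-- The support of `w`: the letters appearing in some reduced decomposition. -/
noncomputable def supp {m : ℕ} (w : Equiv.Perm (Fin m)) : Set ℕ :=
  {i | ∃ l : List ℕ, IsReducedWord w l ∧ i ∈ l}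

/-- `rep w = ℓ(w) - |supp w|`, the number of repeated letters. -/
noncomputable def rep {m : ℕ} (w : Equiv.Perm (Fin m)) : ℕ :=
  len w - (supp w).ncard

/-- The value of `w` at the (0-based) position `i`, as a natural number. -/
def valAt {m : ℕ} (w : Equiv.Perm (Fin m)) (i : ℕ) : ℕ :=
  if h : i < m then (w ⟨i, h⟩ : ℕ) else 0

/-- The (0-based) position at which the value `v` occurs in `w`. -/
def posOf {m : ℕ} (w : Equiv.Perm (Fin m)) (v : ℕ) : ℕ :=
  if h : v < m then (w⁻¹ ⟨v, h⟩ : ℕ) else 0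

/-- `Mstat w k`: the maximum of the first `k + 1` entries of `w`. -/
noncomputable def Mstat {m : ℕ} (w : Equiv.Perm (Fin m)) (k : ℕ) : ℕ :=
  sSup {v | ∃ i : Fin m, (i : ℕ) ≤ k ∧ (w i : ℕ) = v}

/-- `mstat w k`: the minimum of the entries of `w` in positions `> k`. -/
noncomputable def mstat {m : ℕ} (w : Equiv.Perm (Fin m)) (k : ℕ) : ℕ :=
  sInf {v | ∃ i : Fin m, k < (i : ℕ) ∧ (w i : ℕ) = v}

/-- `wbar` is obtained from `w` by deleting the largest letter from the one-line
notation of `w` and sliding all subsequent letters one space to the left. -/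
def IsDeletion {n : ℕ} (w : Equiv.Perm (Fin (n + 1))) (wbar : Equiv.Perm (Fin n)) : Prop :=
  ∀ i : Fin n, (wbar i : ℕ) =
    if (i : ℕ) < posOf w n then valAt w (i : ℕ) else valAt w ((i : ℕ) + 1)

/-- `newrep w wbar`: the letters `k` with `s_k ∈ supp(wbar)` and `w⁻¹(top) ≤ k`. -/
noncomputable def newrep {n : ℕ} (w : Equiv.Perm (Fin (n + 1))) (wbar : Equiv.Perm (Fin n)) :
    Set ℕ :=
  {k | k ∈ supp wbar ∧ posOf w n ≤ k}

/-- An occurrence of the pattern `p` in `w`, recorded by its set `S` of values: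
there are positions `f 0 < f 1 < ⋯` whose values are in the same relative order
as `p`, and `S` is the corresponding set of values. -/
def IsOccSet {m c : ℕ} (p : Fin c → ℕ) (w : Equiv.Perm (Fin m)) (S : Finset ℕ) : Prop :=
  ∃ f : Fin c → Fin m, StrictMono f ∧ (∀ a b : Fin c, p a < p b ↔ w (f a) < w (f b)) ∧
    S = Finset.image (fun a => (w (f a) : ℕ)) Finset.univ

/-- An `N`-occurrence (here `N = n`, the largest 0-based value): an occurrence
whose largest letter is the largest value of `w`. -/
def IsTopOccSet {n c : ℕ} (p : Fin c → ℕ) (w : Equiv.Perm (Fin (n + 1))) (S : Finset ℕ) : Prop :=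
  IsOccSet p w S ∧ n ∈ S

/-- The number of occurrences of the pattern `p` in `w`. -/
noncomputable def occCount {m c : ℕ} (p : Fin c → ℕ) (w : Equiv.Perm (Fin m)) : ℕ :=
  Set.ncard {S : Finset ℕ | IsOccSet p w S}

/-- The number of `N`-occurrences of the pattern `p` in `w`. -/
noncomputable def topOccCount {n c : ℕ} (p : Fin c → ℕ) (w : Equiv.Perm (Fin (n + 1))) : ℕ :=
  Set.ncard {S : Finset ℕ | IsTopOccSet p w S}

def p321 : Fin 3 → ℕ := ![3, 2, 1]
def p3412 : Fin 4 → ℕ := ![3, 4, 1, 2]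
def p4321 : Fin 4 → ℕ := ![4, 3, 2, 1]
def p34512 : Fin 5 → ℕ := ![3, 4, 5, 1, 2]
def p45123 : Fin 5 → ℕ := ![4, 5, 1, 2, 3]
def p35412 : Fin 5 → ℕ := ![3, 5, 4, 1, 2]
def p43512 : Fin 5 → ℕ := ![4, 3, 5, 1, 2]
def p45132 : Fin 5 → ℕ := ![4, 5, 1, 3, 2]
def p45213 : Fin 5 → ℕ := ![4, 5, 2, 1, 3]
def p53412 : Fin 5 → ℕ := ![5, 3, 4, 1, 2]
def p45312 : Fin 5 → ℕ := ![4, 5, 3, 1, 2]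
def p45231 : Fin 5 → ℕ := ![4, 5, 2, 3, 1]

/-- The pattern `𝔭_k(w)` of Definition 4.4, recorded as its set of values:
(I) if `w⁻¹(top)` is left of `w⁻¹(M_k)`, the 321-occurrence `{top, M_k, m_k}`;
(II) else if `wbar(k) > m_k`, the 321-occurrence `{top, wbar(k), m_k}`;
(III) otherwise the 3412-occurrence `{M_k, top, wbar(k), m_k}`. -/
noncomputable def pocc {n : ℕ} (w : Equiv.Perm (Fin (n + 1))) (wbar : Equiv.Perm (Fin n))
    (k : ℕ) : Finset ℕ :=
  if posOf w n < posOf w (Mstat wbar k) then {n, Mstat wbar k, mstat wbar k}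
  else if mstat wbar k < valAt wbar k then {n, valAt wbar k, mstat wbar k}
  else {Mstat wbar k, n, valAt wbar k, mstat wbar k}

/-- The inversions of `w`, as pairs of positions. -/
def invs {m : ℕ} (w : Equiv.Perm (Fin m)) : Finset (Fin m × Fin m) :=
  {x | x.1 < x.2 ∧ w x.2 < w x.1}

theorem mem_invs {m : ℕ} {w : Equiv.Perm (Fin m)} {x : Fin m × Fin m} :
    x ∈ invs w ↔ x.1 < x.2 ∧ w x.2 < w x.1 := by
  simp [invs]

theorem val_sr_apply {m i : ℕ} (h : i + 1 < m) (a : Fin m) :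
    (sr m i a : ℕ) = if (a : ℕ) = i then i + 1 else if (a : ℕ) = i + 1 then i else a := by
  simp only [sr, dif_pos h, Equiv.swap_apply_def, Fin.ext_iff]
  split_ifs <;> rfl

theorem sr_mul_self (m i : ℕ) : sr m i * sr m i = 1 := by
  unfold sr
  split_ifs <;> simp

theorem notMem_invs_of_lt {m i : ℕ} {u : Equiv.Perm (Fin m)} {a b : Fin m}
    (ha : (u a : ℕ) = i) (hb : (u b : ℕ) = i + 1) : (a, b) ∉ invs u := by
  simp only [mem_invs, Fin.lt_def]
  omega

theorem invs_sr_mul {m i : ℕ} (h : i + 1 < m) {u : Equiv.Perm (Fin m)} {a b : Fin m}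
    (ha : (u a : ℕ) = i) (hb : (u b : ℕ) = i + 1) (hab : a < b) :
    invs (sr m i * u) = insert (a, b) (invs u) := by
  ext ⟨x, y⟩
  have key (z : Fin m) : ((u z : ℕ) = i ↔ z = a) ∧ ((u z : ℕ) = i + 1 ↔ z = b) := by
    constructor
    · rw [← ha, Fin.val_inj, u.injective.eq_iff]
    · rw [← hb, Fin.val_inj, u.injective.eq_iff]
  obtain ⟨hxa, hxb⟩ := key x
  obtain ⟨hya, hyb⟩ := key y
  simp only [mem_invs, Finset.mem_insert, Prod.mk.injEq, Equiv.Perm.mul_apply, Fin.lt_def,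
    val_sr_apply h, ← hxa, ← hyb]
  rw [Fin.ext_iff] at hxa hxb hya hyb
  rw [Fin.lt_def] at hab
  split_ifs <;> omega

theorem card_invs_sr_mul {m i : ℕ} (h : i + 1 < m) {u : Equiv.Perm (Fin m)} {a b : Fin m}
    (ha : (u a : ℕ) = i) (hb : (u b : ℕ) = i + 1) (hab : a < b) :
    (invs (sr m i * u)).card = (invs u).card + 1 := by
  rw [invs_sr_mul h ha hb hab, Finset.card_insert_of_notMem (notMem_invs_of_lt ha hb)]

theorem card_invs_eq_card_sr_mul_add_one {m i : ℕ} (h : i + 1 < m) {u : Equiv.Perm (Fin m)}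
    {a b : Fin m} (ha : (u a : ℕ) = i) (hb : (u b : ℕ) = i + 1) (hba : b < a) :
    (invs u).card = (invs (sr m i * u)).card + 1 := by
  have := card_invs_sr_mul (u := sr m i * u) (a := b) (b := a) h
    (by simp [val_sr_apply h, hb]) (by simp [val_sr_apply h, ha]) hba
  rwa [← mul_assoc, sr_mul_self, one_mul] at this

theorem exists_val_apply_eq {m i : ℕ} (h : i < m) (u : Equiv.Perm (Fin m)) :
    ∃ a, (u a : ℕ) = i :=
  ⟨u⁻¹ ⟨i, h⟩, by simp⟩

theorem IsWord.tail {m i : ℕ} {l : List ℕ} {w : Equiv.Perm (Fin m)} (h : IsWord m (i :: l) w) :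
    i + 1 < m ∧ IsWord m l (sr m i * w) := by
  obtain ⟨h₁, rfl⟩ := h
  refine ⟨h₁ i (by simp), fun j hj => h₁ j (by simp [hj]), ?_⟩
  rw [List.map_cons, List.prod_cons, ← mul_assoc, sr_mul_self, one_mul]

theorem IsWord.cons {m i : ℕ} {l : List ℕ} {u : Equiv.Perm (Fin m)} (h : i + 1 < m)
    (hu : IsWord m l u) : IsWord m (i :: l) (sr m i * u) := by
  refine ⟨by simpa [h] using hu.1, ?_⟩
  rw [List.map_cons, List.prod_cons, hu.2]

theorem IsWord.card_invs_le {m : ℕ} {l : List ℕ} {w : Equiv.Perm (Fin m)} (h : IsWord m l w) :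
    (invs w).card ≤ l.length := by
  induction l generalizing w with
  | nil =>
    obtain ⟨-, rfl⟩ := h
    have : invs (1 : Equiv.Perm (Fin m)) = ∅ := by
      ext x
      simpa [mem_invs] using le_of_lt
    simp [this]
  | cons i l ih =>
    obtain ⟨hi, hl⟩ := h.tail
    have := ih hl
    obtain ⟨a, ha⟩ := exists_val_apply_eq (by omega : i < m) w
    obtain ⟨b, hb⟩ := exists_val_apply_eq hi w
    have hne : a ≠ b := by rintro rfl; omega
    rw [List.length_cons]
    rcases hne.lt_or_gt with hab | hab
    · have := card_invs_sr_mul hi ha hb hab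
      omega
    · have := card_invs_eq_card_sr_mul_add_one hi ha hb hab
      omega

theorem exists_isWord_length_eq {m : ℕ} (w : Equiv.Perm (Fin m)) :
    ∃ l, IsWord m l w ∧ l.length = (invs w).card := by
  induction hc : (invs w).card generalizing w with
  | zero =>
    refine ⟨[], ⟨by simp, ?_⟩, rfl⟩
    have hmono : StrictMono w := fun x y hxy => by
      by_contra! hle
      have : (x, y) ∈ invs w :=
        mem_invs.2 ⟨hxy, lt_of_le_of_ne hle fun h => hxy.ne' (w.injective h)⟩
      rw [Finset.card_eq_zero.1 hc] at this
      simp at this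
    have := Subsingleton.elim (hmono.orderIsoOfSurjective w w.surjective) (OrderIso.refl _)
    ext x
    simpa using congrArg Fin.val (DFunLike.congr_fun this x).symm
  | succ c ih =>
    by_cases hdesc : ∃ i a b, i + 1 < m ∧ (w a : ℕ) = i ∧ (w b : ℕ) = i + 1 ∧ b < a
    · obtain ⟨i, a, b, hi, ha, hb, hba⟩ := hdesc
      have := card_invs_eq_card_sr_mul_add_one hi ha hb hba
      obtain ⟨l, hl, hlen⟩ := ih (sr m i * w) (by omega)
      refine ⟨i :: l, ?_, by simp [hlen]⟩
      simpa [← mul_assoc, sr_mul_self] using hl.cons hi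
    · push Not at hdesc
      obtain ⟨⟨x, y⟩, hxy⟩ := Finset.card_pos.1 (by omega : 0 < (invs w).card)
      obtain ⟨hxy, hwxy⟩ := mem_invs.1 hxy
      dsimp only at hxy hwxy
      rw [Fin.lt_def] at hwxy
      have hle (d : ℕ) (a b : Fin m) (hd : (w b : ℕ) = w a + d) : a ≤ b := by
        induction d generalizing b with
        | zero => exact (w.injective (Fin.ext hd)).ge
        | succ d ihd =>
          obtain ⟨c, hc⟩ := exists_val_apply_eq (i := w a + d) (by omega) w
          exact (ihd c hc).trans (hdesc _ c b (by omega) hc (by omega))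
      exact absurd (hle (w x - w y) y x (by omega)) (not_le.2 hxy)

theorem len_eq_card_invs {m : ℕ} (w : Equiv.Perm (Fin m)) : len w = (invs w).card := by
  refine le_antisymm (Nat.sInf_le (exists_isWord_length_eq w))
    (le_csInf ⟨_, exists_isWord_length_eq w⟩ ?_)
  rintro _ ⟨l, hl, rfl⟩
  exact hl.card_invs_le

theorem exists_isReducedWord {m : ℕ} (w : Equiv.Perm (Fin m)) : ∃ l, IsReducedWord w l := by
  obtain ⟨l, hl, hlen⟩ := exists_isWord_length_eq w
  exact ⟨l, hl, hlen.trans (len_eq_card_invs w).symm⟩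

theorem IsWord.val_le_iff {m k : ℕ} {l : List ℕ} {w : Equiv.Perm (Fin m)} (h : IsWord m l w)
    (hk : k ∉ l) (x : Fin m) : (w x : ℕ) ≤ k ↔ (x : ℕ) ≤ k := by
  induction l generalizing w with
  | nil =>
    obtain ⟨-, rfl⟩ := h
    simp
  | cons i l ih =>
    obtain ⟨hi, hl⟩ := h.tail
    rw [List.mem_cons, not_or] at hk
    rw [← ih hl hk.2, Equiv.Perm.mul_apply, val_sr_apply hi]
    split_ifs <;> omega

/-- Some inversion of `w` straddles the cut between positions `k` and `k + 1`. -/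
def CrossesCut {m : ℕ} (w : Equiv.Perm (Fin m)) (k : ℕ) : Prop :=
  ∃ x y : Fin m, (x : ℕ) ≤ k ∧ k < y ∧ w y < w x

theorem IsReducedWord.mem_iff {m k : ℕ} {l : List ℕ} {w : Equiv.Perm (Fin m)}
    (h : IsReducedWord w l) : k ∈ l ↔ CrossesCut w k := by
  constructor
  · intro hk
    obtain ⟨hw, hlen⟩ := h
    rw [len_eq_card_invs] at hlen
    induction l generalizing w with
    | nil => simp at hk
    | cons i l ih =>
      obtain ⟨hi, hl⟩ := hw.tail
      have hle := hl.card_invs_le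
      obtain ⟨u, rfl⟩ : ∃ u, w = sr m i * u :=
        ⟨sr m i * w, by rw [← mul_assoc, sr_mul_self, one_mul]⟩
      rw [← mul_assoc, sr_mul_self, one_mul] at hl hle
      obtain ⟨a, ha⟩ := exists_val_apply_eq (by omega : i < m) u
      obtain ⟨b, hb⟩ := exists_val_apply_eq hi u
      rw [List.length_cons] at hlen
      have hab : a < b := by
        by_contra! hba
        have hne : b ≠ a := by rintro rfl; omega
        have := card_invs_eq_card_sr_mul_add_one hi ha hb (lt_of_le_of_ne hba hne)
        omega
      have hcard := card_invs_sr_mul hi ha hb hab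
      have hinv := invs_sr_mul hi ha hb hab
      by_cases hkl : k ∈ l
      · obtain ⟨x, y, hx, hy, hxy⟩ := ih hkl hl (by omega)
        have hmem : (x, y) ∈ invs (sr m i * u) := by
          rw [hinv]
          exact Finset.mem_insert_of_mem (mem_invs.2 ⟨Fin.lt_def.2 (by simp only; omega), hxy⟩)
        exact ⟨x, y, hx, hy, (mem_invs.1 hmem).2⟩
      · obtain rfl : k = i := by simpa [hkl] using hk
        have hmem : (a, b) ∈ invs (sr m k * u) := by simp [hinv]
        have hak := hl.val_le_iff hkl a
        have hbk := hl.val_le_iff hkl b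
        exact ⟨a, b, by omega, by omega, (mem_invs.1 hmem).2⟩
  · rintro ⟨x, y, hx, hy, hxy⟩
    by_contra hk
    have hxk := h.1.val_le_iff hk x
    have hyk := h.1.val_le_iff hk y
    rw [Fin.lt_def] at hxy
    omega

theorem mem_supp_iff {m k : ℕ} {w : Equiv.Perm (Fin m)} : k ∈ supp w ↔ CrossesCut w k := by
  constructor
  · rintro ⟨l, hl, hk⟩
    exact hl.mem_iff.1 hk
  · intro hk
    obtain ⟨l, hl⟩ := exists_isReducedWord w
    exact ⟨l, hl, hl.mem_iff.2 hk⟩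

theorem IsReducedWord.supp_eq {m : ℕ} {l : List ℕ} {w : Equiv.Perm (Fin m)}
    (h : IsReducedWord w l) : supp w = (l.toFinset : Set ℕ) := by
  ext k
  rw [mem_supp_iff, ← h.mem_iff]
  simp

theorem finite_supp {m : ℕ} (w : Equiv.Perm (Fin m)) : (supp w).Finite := by
  obtain ⟨l, hl⟩ := exists_isReducedWord w
  rw [hl.supp_eq]
  exact Finset.finite_toSet _

theorem ncard_supp_le_len {m : ℕ} (w : Equiv.Perm (Fin m)) : (supp w).ncard ≤ len w := by
  obtain ⟨l, hl⟩ := exists_isReducedWord w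
  rw [hl.supp_eq, Set.ncard_coe_finset, ← hl.2]
  exact l.toFinset_card_le

theorem card_invs_eq_sum {m : ℕ} (w : Equiv.Perm (Fin m)) :
    (invs w).card = ∑ x, ∑ y, if x < y ∧ w y < w x then 1 else 0 := by
  rw [invs, Finset.card_filter, Fintype.sum_prod_type]

section Deletion

variable {n : ℕ} {w : Equiv.Perm (Fin (n + 1))} {wbar : Equiv.Perm (Fin n)}

theorem posOf_top (w : Equiv.Perm (Fin (n + 1))) : posOf w n = w⁻¹ (Fin.last n) := by
  simp [posOf, Fin.last]

theorem IsDeletion.apply_succAbove (h : IsDeletion w wbar) (i : Fin n) :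
    w ((w⁻¹ (Fin.last n)).succAbove i) = (wbar i).castSucc := by
  apply Fin.ext
  rw [Fin.val_castSucc, h i, posOf_top, Fin.succAbove]
  simp only [Fin.lt_def, Fin.val_castSucc, valAt]
  have := i.isLt
  split_ifs <;> first | rfl | omega

theorem IsDeletion.card_invs (h : IsDeletion w wbar) :
    (invs w).card = (invs wbar).card + (n - posOf w n) := by
  have hp : w (w⁻¹ (Fin.last n)) = Fin.last n := by simp
  rw [posOf_top, card_invs_eq_sum, card_invs_eq_sum,
    Fin.sum_univ_succAbove _ (w⁻¹ (Fin.last n)), add_comm]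
  congr 1
  · refine Finset.sum_congr rfl fun i _ => ?_
    rw [Fin.sum_univ_succAbove _ (w⁻¹ (Fin.last n)), hp]
    simp_rw [h.apply_succAbove, Fin.succAbove_lt_succAbove_iff, Fin.castSucc_lt_castSucc_iff]
    simp [(Fin.le_last _).not_gt]
  · have hiff (y : Fin (n + 1)) : (w⁻¹ (Fin.last n) < y ∧ w y < w (w⁻¹ (Fin.last n))) ↔
        w⁻¹ (Fin.last n) < y := by
      refine and_iff_left_of_imp fun hy => ?_
      rw [hp, Fin.lt_last_iff_ne_last]
      rintro hy'
      exact hy.ne (by simp [← hy'])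
    simp_rw [hiff]
    rw [← Finset.card_filter, Finset.filter_lt_eq_Ioi, Fin.card_Ioi]
    omega

theorem IsDeletion.crossesCut_iff (h : IsDeletion w wbar) (k : ℕ) :
    CrossesCut w k ↔ CrossesCut wbar k ∨ posOf w n ≤ k ∧ k < n := by
  rw [posOf_top]
  have hp : w (w⁻¹ (Fin.last n)) = Fin.last n := by simp
  have hw := h.apply_succAbove
  generalize w⁻¹ (Fin.last n) = p at hp hw
  have hval (i : Fin n) : (p.succAbove i : ℕ) = if (i : ℕ) < p then (i : ℕ) else i + 1 := by
    simp only [Fin.succAbove, Fin.lt_def, Fin.val_castSucc]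
    split_ifs <;> rfl
  by_cases hk : (p : ℕ) ≤ k
  · constructor
    · rintro ⟨x, y, hx, hy, hxy⟩
      exact Or.inr ⟨hk, by omega⟩
    · intro hor
      have hkn : k < n := by
        rcases hor with ⟨x, y, hx, hy, hxy⟩ | hkn
        · omega
        · exact hkn.2
      refine ⟨p, ⟨k + 1, by omega⟩, hk, by simp, ?_⟩
      rw [hp, Fin.lt_last_iff_ne_last, ← hp, w.injective.ne_iff, Ne, Fin.ext_iff]
      simp only
      omega
  · constructor
    · rintro ⟨x, y, hx, hy, hxy⟩
      have hxp : x ≠ p := by rintro rfl; omega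
      have hyp : y ≠ p := by
        rintro rfl
        rw [hp] at hxy
        exact (Fin.le_last _).not_gt hxy
      obtain ⟨i, rfl⟩ := Fin.exists_succAbove_eq hxp
      obtain ⟨j, rfl⟩ := Fin.exists_succAbove_eq hyp
      rw [hw, hw, Fin.castSucc_lt_castSucc_iff] at hxy
      rw [hval] at hx hy
      exact Or.inl ⟨i, j, by split_ifs at hx <;> omega, by split_ifs at hy <;> omega, hxy⟩
    · rintro (⟨x, y, hx, hy, hxy⟩ | ⟨hpk, -⟩)
      · refine ⟨p.succAbove x, p.succAbove y, ?_, ?_, ?_⟩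
        · rw [hval]; split_ifs <;> omega
        · rw [hval]; split_ifs <;> omega
        · rwa [hw, hw, Fin.castSucc_lt_castSucc_iff]
      · exact absurd hpk hk

theorem IsDeletion.supp_eq (h : IsDeletion w wbar) :
    supp w = supp wbar ∪ Set.Ico (posOf w n) n := by
  ext k
  rw [Set.mem_union, mem_supp_iff, mem_supp_iff, h.crossesCut_iff, Set.mem_Ico]

theorem newrep_eq_inter (w : Equiv.Perm (Fin (n + 1))) (wbar : Equiv.Perm (Fin n)) :
    newrep w wbar = supp wbar ∩ Set.Ico (posOf w n) n := by
  ext k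
  simp only [newrep, Set.mem_ofPred_eq, Set.mem_inter_iff, Set.mem_Ico]
  refine and_congr_right fun hk => (and_iff_left ?_).symm
  obtain ⟨x, y, hx, hy, hxy⟩ := mem_supp_iff.1 hk
  omega

end Deletion

/-- `rep(w) = rep(wbar) + |newrep(w)|`. -/
theorem rep_eq_rep_deletion_add_newrep {n : ℕ} (w : Equiv.Perm (Fin (n + 1)))
    (wbar : Equiv.Perm (Fin n)) (hdel : IsDeletion w wbar) :
    rep w = rep wbar + (newrep w wbar).ncard := by
  have hlen : len w = len wbar + (n - posOf w n) := by
    rw [len_eq_card_invs, len_eq_card_invs, hdel.card_invs]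
  have hcard := Set.ncard_union_add_ncard_inter (supp wbar) (Set.Ico (posOf w n) n)
    (finite_supp wbar) (Set.finite_Ico _ _)
  rw [← hdel.supp_eq, ← newrep_eq_inter, ← Finset.coe_Ico, Set.ncard_coe_finset,
    Nat.card_Ico] at hcard
  have hle := ncard_supp_le_len wbar
  unfold rep
  omega
end

section
/- Let w ∈ S_N. There are no distinct k, k' ∈ newrep(w) for which 𝔭_k(w) and 𝔭_{k'}(w) are the same N-occurrence of the pattern 3412 in w. -/
theorem lt_of_mem_supp {m k : ℕ} {w : Equiv.Perm (Fin m)} (hk : k ∈ supp w) : k < m := by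
  obtain ⟨l, ⟨⟨hl, -⟩, -⟩, hkl⟩ := hk
  have := hl k hkl
  omega

theorem valAt_lt {m k : ℕ} (w : Equiv.Perm (Fin m)) (hk : k < m) : valAt w k < m := by
  simp [valAt, hk]

theorem valAt_injOn {m j k : ℕ} (w : Equiv.Perm (Fin m)) (hj : j < m) (hk : k < m)
    (h : valAt w j = valAt w k) : j = k := by
  simpa [valAt, hj, hk, Fin.val_inj] using h

theorem valAt_le_Mstat {m k : ℕ} (w : Equiv.Perm (Fin m)) (hk : k < m) :
    valAt w k ≤ Mstat w k := by
  refine le_csSup ⟨m, ?_⟩ ⟨⟨k, hk⟩, le_rfl, by simp [valAt, hk]⟩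
  rintro _ ⟨i, -, rfl⟩
  exact (w i).isLt.le

/-- An occurrence of a pattern of size `c` involves exactly `c` values. -/
theorem IsOccSet.card_eq {m c : ℕ} {p : Fin c → ℕ} {w : Equiv.Perm (Fin m)} {S : Finset ℕ}
    (h : IsOccSet p w S) : S.card = c := by
  obtain ⟨f, hf, -, rfl⟩ := h
  have hinj : Function.Injective fun a => (w (f a) : ℕ) :=
    Fin.val_injective.comp (w.injective.comp hf.injective)
  rw [Finset.card_image_of_injective _ hinj, Finset.card_univ, Fintype.card_fin]

/-- If `𝔭_k(w)` has four letters, then the smallest of them is `wbar(k)`. -/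
theorem isLeast_pocc {n k : ℕ} (w : Equiv.Perm (Fin (n + 1))) (wbar : Equiv.Perm (Fin n))
    (hk : k < n) (hcard : (pocc w wbar k).card = 4) :
    IsLeast (pocc w wbar k : Set ℕ) (valAt wbar k) := by
  have hn := valAt_lt wbar hk
  have hM := valAt_le_Mstat wbar hk
  unfold pocc at hcard ⊢
  split_ifs at hcard ⊢ with h₁ h₂
  · have := Finset.card_le_three (a := n) (b := Mstat wbar k) (c := mstat wbar k)
    omega
  · have := Finset.card_le_three (a := n) (b := valAt wbar k) (c := mstat wbar k)
    omega
  · refine ⟨by simp, fun x hx => ?_⟩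
    simp only [Finset.coe_insert, Finset.coe_singleton, Set.mem_insert_iff,
      Set.mem_singleton_iff] at hx
    omega

/-- no two distinct `k, k' ∈ newrep(w)` give the same `N`-occurrence of
the pattern 3412. -/
theorem no_3412_overcounting {n : ℕ} (w : Equiv.Perm (Fin (n + 1)))
    (wbar : Equiv.Perm (Fin n)) (hdel : IsDeletion w wbar) :
    ¬ ∃ k k' : ℕ, k ∈ newrep w wbar ∧ k' ∈ newrep w wbar ∧ k ≠ k' ∧
      pocc w wbar k = pocc w wbar k' ∧ IsTopOccSet p3412 w (pocc w wbar k) := by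
  rintro ⟨k, k', ⟨hk, -⟩, ⟨hk', -⟩, hne, heq, hocc, -⟩
  have hkn := lt_of_mem_supp hk
  have hkn' := lt_of_mem_supp hk'
  have hleast := isLeast_pocc w wbar hkn hocc.card_eq
  have hleast' := isLeast_pocc w wbar hkn' (heq ▸ hocc.card_eq)
  rw [heq] at hleast
  exact hne (valAt_injOn wbar hkn hkn' (hleast.unique hleast'))
end
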